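/- Let α ∈ (0,1), β > 0, and set λ = β. Define f₁ : [0,1] → ℝ by f₁(r) = ((β+1)/(3β))r − α(β+1)/(6β(1−α)) + α³(β+1)/(6β(1−α)³(r + α/(1−α))²). Then f₁ is differentiable on (0,1] and for every r ∈ (0,1] it satisfies β·f₁′(r) = ((1−α)r+α)^0 − α/((1−α)r+α) − (1−α)·2β·f₁(r)/((1−α)r+α) + (1−α)βr/((1−α)r+α), i.e. f₁ satisfies Country 1's mutual best-response differential equation λ·f₁′(r) = K₀((1−α)r+α)^(β/λ−1) − α/((1−α)r+α) − (1−α)(β+λ)f₁(r)/((1−α)r+α) + (1−α)βr/((1−α)r+α) with λ = β and K₀ = 1. -/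

import Mathlib

/-- Part of Theorem 1: the explicit strategy `f₁` for the case `λ = β` satisfies
Country 1's mutual best-response differential equation with `λ = β` and `K₀ = 1`. -/
theorem theorem1_f1_satisfies_ODE
    (α lam β : ℝ) (hα : α ∈ Set.Ioo (0:ℝ) 1) (hβ : 0 < β) (hlam : lam = β)
    (f₁ : ℝ → ℝ)
    (hf₁ : ∀ r : ℝ, f₁ r =
      ((β + 1) / (3 * β)) * r
      - α * (β + 1) / (6 * β * (1 - α))
      + α ^ 3 * (β + 1) / (6 * β * (1 - α) ^ 3 * (r + α / (1 - α)) ^ 2)) :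
    ∀ r ∈ Set.Ioc (0:ℝ) 1, ∃ d : ℝ, HasDerivAt f₁ d r ∧
      β * d = ((1 - α) * r + α) ^ (0:ℝ)
        - α / ((1 - α) * r + α)
        - (1 - α) * (2 * β) * f₁ r / ((1 - α) * r + α)
        + (1 - α) * β * r / ((1 - α) * r + α) := by
  intro r hr
  obtain ⟨h0, h1⟩ := hα
  obtain ⟨hr0, hr1⟩ := hr
  have ha : 0 < 1 - α := by linarith
  have hane := ha.ne'
  have hbne := hβ.ne'
  obtain ⟨c, hc⟩ : ∃ c, c = α / (1 - α) := ⟨_, rfl⟩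
  have hcpos : 0 < c := by rw [hc]; positivity
  have hαc : α = (1 - α) * c := by rw [hc]; field_simp
  have hu : 0 < r + c := by linarith
  have hune := hu.ne'
  have hf : f₁ = fun x => ((β + 1) / (3 * β)) * x - c * (β + 1) / (6 * β)
      + c ^ 3 * (β + 1) / (6 * β) * ((x + c) ^ 2)⁻¹ := by
    funext x
    rw [hf₁ x, ← hc]
    have e1 : α * (β + 1) / (6 * β * (1 - α)) = c * (β + 1) / (6 * β) := by
      rw [hc]; field_simp
    have e2 : α ^ 3 * (β + 1) / (6 * β * (1 - α) ^ 3 * (x + c) ^ 2)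
        = c ^ 3 * (β + 1) / (6 * β) * ((x + c) ^ 2)⁻¹ := by
      have e3 : c ^ 3 = α ^ 3 / (1 - α) ^ 3 := by rw [hc, div_pow]
      rw [e3]; simp only [div_eq_mul_inv, mul_inv]; ring
    rw [e1, e2]
  have hD : (1 - α) * r + α = (1 - α) * (r + c) := by linarith
  refine ⟨(β + 1) / (3 * β) + c ^ 3 * (β + 1) / (6 * β) *
    (-(2 * (r + c)) / ((r + c) ^ 2) ^ 2), ?_, ?_⟩
  · rw [hf]
    have hd : HasDerivAt (fun x : ℝ => (x + c) ^ 2) (2 * (r + c)) r := by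
      simpa using ((hasDerivAt_id r).add_const c).fun_pow 2
    have hi := (hd.fun_inv (by positivity)).const_mul (c ^ 3 * (β + 1) / (6 * β))
    have hl := (((hasDerivAt_id r).const_mul ((β + 1) / (3 * β))).sub_const
      (c * (β + 1) / (6 * β))).add hi
    rw [mul_one] at hl
    exact hl
  · rw [Real.rpow_zero, hD, hf]
    have e : α / ((1 - α) * (r + c)) = c / (r + c) := by
      rw [hc]; rw [hc] at hune; field_simp
    rw [e]
    field_simp
    ring
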